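/- Let Ω be a nonempty compact metric space and P a Borel probability measure on Ω whose topological support is connected. If (X_1, X_2, …) is an i.i.d. sequence of Ω-valued random variables with law P, then with probability 1 the quantity inf{ζ > 0 : (X_1, …, X_n) is ζ-informative} converges to 0 as n → ∞. -/

import Mathlib

open MeasureTheory Metric Set Filter

/-- A finite sequence `ω : Fin n → Ω` is `ζ`-informative for the measure `P` if for every
subset `X` of indices, the measure of the union of the `ζ`-balls centered at the chosen points
is at least `|X| / n`. -/
def ZetaInformative {Ω : Type*} [MetricSpace Ω] [MeasurableSpace Ω]
    (P : Measure Ω) {n : ℕ} (ω : Fin n → Ω) (ζ : ℝ) : Prop :=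
  ∀ X : Finset (Fin n), ((X.card : ℝ) / n) ≤ (P (⋃ i ∈ X, ball (ω i) ζ)).toReal

/-- The topological support of a measure: the set of points all of whose open neighborhoods
have positive measure. -/
def measSupport {Ω : Type*} [TopologicalSpace Ω] [MeasurableSpace Ω] (P : Measure Ω) : Set Ω :=
  {x | ∀ U : Set Ω, IsOpen U → x ∈ U → 0 < P U}

/-- The strong law of large numbers for the empirical frequency of a measurable set. -/
lemma ae_tendsto_empirical_measure {Ω α : Type*} [MeasurableSpace Ω] [MeasurableSpace α]
    {P : Measure Ω} {μ : Measure α} [IsProbabilityMeasure μ]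
    {X : ℕ → α → Ω} (hmeas : ∀ i, Measurable (X i)) (hlaw : ∀ i, μ.map (X i) = P)
    (hindep : ProbabilityTheory.iIndepFun X μ) {U : Set Ω} (hU : MeasurableSet U) :
    ∀ᵐ a ∂μ, Tendsto
      (fun n : ℕ => (∑ i ∈ Finset.range n, U.indicator (fun _ => (1 : ℝ)) (X i a)) / n)
      atTop (nhds (P U).toReal) := by
  have hind : Measurable (U.indicator fun _ => (1 : ℝ)) := measurable_const.indicator hU
  have hmean : ∫ a, U.indicator (fun _ => (1 : ℝ)) (X 0 a) ∂μ = (P U).toReal := by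
    rw [← integral_map (hmeas 0).aemeasurable hind.aestronglyMeasurable, hlaw 0,
      integral_indicator_const _ hU]
    simp [Measure.real]
  rw [← hmean]
  refine ProbabilityTheory.strong_law_ae_real
    (fun i a => U.indicator (fun _ => (1 : ℝ)) (X i a)) ?_ ?_ ?_
  · refine Integrable.of_bound (hind.comp (hmeas 0)).aestronglyMeasurable 1 (ae_of_all _ fun a => ?_)
    by_cases h : X 0 a ∈ U <;> simp [h]
  · intro i j hij
    exact (hindep.indepFun hij).comp hind hind
  · intro i
    have hX : ProbabilityTheory.IdentDistrib (X i) (X 0) μ μ :=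
      ⟨(hmeas i).aemeasurable, (hmeas 0).aemeasurable, by rw [hlaw, hlaw]⟩
    exact hX.comp hind

lemma measSupport_eq_support {Ω : Type*} [TopologicalSpace Ω] [MeasurableSpace Ω]
    (P : Measure Ω) : measSupport P = P.support := by
  ext x
  rw [Measure.mem_support_iff_forall]
  refine ⟨fun h V hV => ?_, fun h V hV hx => h V (hV.mem_nhds hx)⟩
  obtain ⟨W, hWV, hW, hx⟩ := mem_nhds_iff.1 hV
  exact (h W hW hx).trans_le (measure_mono hWV)

/-- If the support of `P` is connected, thickening further a set that meets the support strictly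
increases the measure, unless the full measure has been reached. -/
lemma measure_thickening_lt_or_eq_one {Ω : Type*} [MetricSpace Ω] [SecondCountableTopology Ω]
    [MeasurableSpace Ω] [BorelSpace Ω] {P : Measure Ω} [IsProbabilityMeasure P]
    (hconn : IsPreconnected P.support) {A : Set Ω} (hA : (A ∩ P.support).Nonempty) {ε δ : ℝ}
    (hε : 0 < ε) (hεδ : ε < δ) :
    P (thickening ε A) < P (thickening δ A) ∨ P (thickening δ A) = 1 := by
  have hsub : cthickening ε A ⊆ thickening δ A :=
    cthickening_subset_thickening' (hε.trans hεδ) hεδ A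
  by_cases hne : (P.support ∩ (thickening δ A ∩ (cthickening ε A)ᶜ)).Nonempty
  · obtain ⟨x, hxS, hx⟩ := hne
    left
    have hopen : IsOpen (thickening δ A ∩ (cthickening ε A)ᶜ) :=
      isOpen_thickening.inter isClosed_cthickening.isOpen_compl
    have hpos : 0 < P (thickening δ A ∩ (cthickening ε A)ᶜ) :=
      (Measure.mem_support_iff_forall x).1 hxS _ (hopen.mem_nhds hx)
    calc P (thickening ε A) < P (thickening ε A) + P (thickening δ A ∩ (cthickening ε A)ᶜ) :=
          ENNReal.lt_add_right (measure_ne_top _ _) hpos.ne'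
      _ = P (thickening ε A ∪ (thickening δ A ∩ (cthickening ε A)ᶜ)) := by
          refine (measure_union ?_ hopen.measurableSet).symm
          rw [Set.disjoint_left]
          exact fun y hy hy' => hy'.2 (thickening_subset_cthickening _ _ hy)
      _ ≤ P (thickening δ A) := measure_mono (union_subset
          ((thickening_subset_cthickening _ _).trans hsub) inter_subset_left)
  · right
    have hS : P.support ⊆ thickening δ A := by
      by_contra hS
      obtain ⟨y, hyS, hy⟩ := Set.not_subset.1 hS
      obtain ⟨x, hxA, hxS⟩ := hA
      refine hne (hconn _ _ isOpen_thickening isClosed_cthickening.isOpen_compl ?_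
        ⟨x, hxS, self_subset_thickening (hε.trans hεδ) A hxA⟩ ⟨y, hyS, fun h => hy (hsub h)⟩)
      intro z _
      by_cases hz : z ∈ cthickening ε A
      · exact Or.inl (hsub hz)
      · exact Or.inr hz
    exact (mem_ae_iff_prob_eq_one isOpen_thickening.measurableSet).1
      (mem_of_superset Measure.support_mem_ae hS)

lemma ae_eventually_zetaInformative {Ω : Type*} [MetricSpace Ω] [CompactSpace Ω]
    [MeasurableSpace Ω] [BorelSpace Ω] {P : Measure Ω} [IsProbabilityMeasure P]
    (hconn : IsPreconnected P.support)
    {α : Type*} [MeasurableSpace α] {μ : Measure α} [IsProbabilityMeasure μ]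
    {X : ℕ → α → Ω} (hmeas : ∀ i, Measurable (X i)) (hlaw : ∀ i, μ.map (X i) = P)
    (hindep : ProbabilityTheory.iIndepFun X μ) {ζ : ℝ} (hζ : 0 < ζ) :
    ∀ᵐ a ∂μ, ∀ᶠ n : ℕ in atTop, ZetaInformative P (fun i : Fin n => X i a) ζ := by
  classical
  obtain ⟨ε, hε, rfl⟩ : ∃ ε, 0 < ε ∧ ζ = ε + 2 * ε := ⟨ζ / 3, by positivity, by ring⟩
  obtain ⟨t, htS, htfin, hcover⟩ :=
    (Measure.isClosed_support (μ := P)).isCompact.finite_cover_balls hε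
  lift t to Finset Ω using htfin
  have hsupp : ∀ᵐ a ∂μ, ∀ i, X i a ∈ P.support := by
    refine ae_all_iff.2 fun i => ?_
    have h : ∀ᵐ x ∂(μ.map (X i)), x ∈ P.support := by
      rw [hlaw]; exact Measure.support_mem_ae
    exact ae_of_ae_map (hmeas i).aemeasurable h
  have hslln : ∀ᵐ a ∂μ, ∀ K ∈ t.powerset, Tendsto
      (fun n : ℕ => (∑ i ∈ Finset.range n,
        (thickening ε (K : Set Ω)).indicator (fun _ => (1 : ℝ)) (X i a)) / n)
      atTop (nhds (P (thickening ε (K : Set Ω))).toReal) :=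
    (Finset.eventually_all _).2 fun K _ =>
      ae_tendsto_empirical_measure hmeas hlaw hindep isOpen_thickening.measurableSet
  filter_upwards [hsupp, hslln] with a ha hlim
  have hle : ∀ K ∈ t.powerset, ∀ᶠ n : ℕ in atTop, (∑ i ∈ Finset.range n,
      (thickening ε (K : Set Ω)).indicator (fun _ => (1 : ℝ)) (X i a)) / n
        ≤ (P (thickening (2 * ε) (K : Set Ω))).toReal := by
    intro K hK
    rcases K.eq_empty_or_nonempty with rfl | ⟨c, hc⟩
    · simp
    rcases measure_thickening_lt_or_eq_one hconn
      ⟨c, hc, htS (Finset.mem_powerset.1 hK hc)⟩ hε (by linarith : ε < 2 * ε) with h | h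
    · exact ((hlim K hK).eventually_lt_const
        ((ENNReal.toReal_lt_toReal (measure_ne_top _ _) (measure_ne_top _ _)).2 h)).mono
          fun _ h => h.le
    · refine Eventually.of_forall fun n => ?_
      rw [h, ENNReal.toReal_one]
      refine div_le_one_of_le₀ ?_ n.cast_nonneg
      calc _ ≤ ∑ i ∈ Finset.range n, (1 : ℝ) := Finset.sum_le_sum fun i _ =>
            Set.indicator_le_self' (fun _ _ => zero_le_one) _
        _ = n := by simp
  filter_upwards [(Finset.eventually_all _).2 hle] with n hn J
  set K := t.filter fun c => ∃ i ∈ J, X i a ∈ ball c ε with hKdef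
  refine le_trans ?_ ((hn K (Finset.mem_powerset.2 (Finset.filter_subset _ _))).trans ?_)
  · gcongr
    rw [Finset.sum_range, Finset.card_eq_sum_ones, Nat.cast_sum]
    refine (Finset.sum_le_sum fun i hi => ?_).trans (Finset.sum_le_sum_of_subset_of_nonneg
      J.subset_univ fun i _ _ => Set.indicator_nonneg (fun _ _ => zero_le_one) _)
    obtain ⟨c, hct, hc⟩ := mem_iUnion₂.1 (hcover (ha i))
    have hmem : X i a ∈ thickening ε (K : Set Ω) :=
      mem_thickening_iff.2 ⟨c, by simpa [hKdef] using ⟨hct, i, hi, hc⟩, hc⟩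
    simp [hmem]
  · refine ENNReal.toReal_mono (measure_ne_top _ _) (measure_mono fun y hy => ?_)
    obtain ⟨c, hcK, hyc⟩ := mem_thickening_iff.1 hy
    obtain ⟨-, i, hi, hic⟩ := Finset.mem_filter.1 (Finset.mem_coe.1 hcK)
    refine mem_iUnion₂.2 ⟨i, hi, ?_⟩
    rw [mem_ball, dist_comm] at hic ⊢
    linarith [dist_triangle_left (X i a) y c, dist_comm c y, dist_comm c (X i a)]

/-- If `Ω` is a nonempty compact metric space and `P` a Borel probability measure on `Ω` with
connected topological support, and `X 0, X 1, …` is an i.i.d. sequence with law `P`, then almost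
surely `inf {ζ > 0 | (X 0, …, X (n-1)) is ζ-informative} → 0` as `n → ∞`. -/
theorem stmt0 {Ω : Type*} [MetricSpace Ω] [CompactSpace Ω] [Nonempty Ω]
    [MeasurableSpace Ω] [BorelSpace Ω]
    (P : Measure Ω) [IsProbabilityMeasure P]
    (hconn : IsConnected (measSupport P))
    {α : Type*} [MeasurableSpace α] (μ : Measure α) [IsProbabilityMeasure μ]
    (X : ℕ → α → Ω) (hmeas : ∀ i, Measurable (X i))
    (hlaw : ∀ i, μ.map (X i) = P)
    (hindep : ProbabilityTheory.iIndepFun X μ) :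
    ∀ᵐ a ∂μ, Tendsto
      (fun n : ℕ => sInf {ζ : ℝ | 0 < ζ ∧ ZetaInformative P (fun i : Fin n => X i a) ζ})
      atTop (nhds 0) := by
  rw [measSupport_eq_support] at hconn
  have h : ∀ᵐ a ∂μ, ∀ k : ℕ, ∀ᶠ n : ℕ in atTop,
      ZetaInformative P (fun i : Fin n => X i a) (1 / ((k : ℝ) + 1)) :=
    ae_all_iff.2 fun k => ae_eventually_zetaInformative hconn.isPreconnected hmeas hlaw hindep
      Nat.one_div_pos_of_nat
  filter_upwards [h] with a ha
  refine tendsto_order.2 ⟨fun b hb => Eventually.of_forall fun n =>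
    hb.trans_le (Real.sInf_nonneg fun ζ hζ => hζ.1.le), fun b hb => ?_⟩
  obtain ⟨k, hk⟩ := exists_nat_one_div_lt hb
  filter_upwards [ha k] with n hn
  have hmem : 1 / ((k : ℝ) + 1) ∈
      {ζ : ℝ | 0 < ζ ∧ ZetaInformative P (fun i : Fin n => X i a) ζ} :=
    ⟨Nat.one_div_pos_of_nat, hn⟩
  exact (csInf_le ⟨0, fun ζ hζ => hζ.1.le⟩ hmem).trans_lt hk
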